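/- arXiv:1211.6871 — 2 statements merged into one kernel-verified Lean document; each statement's English description precedes it below -/
import Mathlib

section
/- Let R be a commutative ring and I an ideal of R. Let u, v ∈ Um_3(R, I) and let α ∈ SL_3(R) with α ≡ I_3 mod I be such that u·α = v and such that the 4×4 block-diagonal matrix diag(1, α) lies in E_4(R, I). Then there exists ε ∈ E_3(R, I) with u·ε = v; that is, u and v are elementarily equivalent relative to I. -/
open Matrix

/-- The set of unimodular rows of length `n` over `R`. -/
def Um (n : ℕ) (R : Type*) [CommRing R] : Set (Fin n → R) :=
  {v | ∃ w : Fin n → R, ∑ i, v i * w i = 1}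

/-- The set of unimodular rows of length `n` relative to the ideal `I`:
unimodular rows congruent to `(1, 0, …, 0)` modulo `I`. -/
def UmRel (n : ℕ) (R : Type*) [CommRing R] (I : Ideal R) : Set (Fin n → R) :=
  {v | v ∈ Um n R ∧ ∀ i : Fin n, if i.val = 0 then v i - 1 ∈ I else v i ∈ I}

/-- The elementary subgroup `E_n(R)` of `GL_n(R)`, generated by the elementary
matrices `E_{ij}(c) = 1 + c·e_{ij}`, `i ≠ j` (i.e. transvections). -/
def Elem (n : ℕ) (R : Type*) [CommRing R] : Subgroup (GL (Fin n) R) :=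
  Subgroup.closure {g | ∃ i j : Fin n, i ≠ j ∧ ∃ c : R,
    (g : Matrix (Fin n) (Fin n) R) = Matrix.transvection i j c}

/-- The relative elementary subgroup `E_n(R, I)`: the smallest normal subgroup of
`E_n(R)` containing the matrices `E_{21}(x)`, `x ∈ I`; realized as the subgroup
generated by all `E_n(R)`-conjugates of such matrices. -/
def ElemRel (n : ℕ) (R : Type*) [CommRing R] (I : Ideal R) : Subgroup (GL (Fin n) R) :=
  Subgroup.closure {g | ∃ e ∈ Elem n R, ∃ h : GL (Fin n) R, ∃ i j : Fin n,
    i.val = 1 ∧ j.val = 0 ∧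
    (∃ x ∈ I, (h : Matrix (Fin n) (Fin n) R) = Matrix.transvection i j x) ∧
    g = e * h * e⁻¹}

namespace RelElem

open scoped commutatorElement

variable {R : Type*} [CommRing R]

/-- The elementary matrix `E_{ij}(c)` as an element of the general linear group. -/
def elemGL {n : ℕ} (i j : Fin n) (h : i ≠ j) (c : R) : GL (Fin n) R where
  val := transvection i j c
  inv := transvection i j (-c)
  val_inv := by rw [transvection_mul_transvection_same _ _ h, add_neg_cancel, transvection_zero]
  inv_val := by rw [transvection_mul_transvection_same _ _ h, neg_add_cancel, transvection_zero]

lemma elemGL_mem {n : ℕ} (i j : Fin n) (h : i ≠ j) (c : R) : elemGL i j h c ∈ Elem n R :=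
  Subgroup.subset_closure ⟨i, j, h, c, rfl⟩

lemma elemGL_zero {n : ℕ} (i j : Fin n) (h : i ≠ j) : elemGL i j h (0 : R) = 1 :=
  Units.ext (transvection_zero i j)

lemma elemGL_neg {n : ℕ} (i j : Fin n) (h : i ≠ j) (c : R) :
    elemGL i j h (-c) = (elemGL i j h c)⁻¹ := Units.ext rfl

lemma elemGL_add {n : ℕ} (i j : Fin n) (h : i ≠ j) (c d : R) :
    elemGL i j h (c + d) = elemGL i j h c * elemGL i j h d :=
  Units.ext (transvection_mul_transvection_same i j h c d).symm

lemma eq_elemGL {n : ℕ} {g : GL (Fin n) R} {i j : Fin n} (h : i ≠ j) {c : R}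
    (hg : (g : Matrix (Fin n) (Fin n) R) = transvection i j c) : g = elemGL i j h c :=
  Units.ext hg

lemma elemRel_conj {n : ℕ} {I : Ideal R} {e g : GL (Fin n) R} (he : e ∈ Elem n R)
    (hg : g ∈ ElemRel n R I) : e * g * e⁻¹ ∈ ElemRel n R I := by
  induction hg using Subgroup.closure_induction with
  | mem g hg =>
    obtain ⟨f, hf, h, i, j, hi, hj, hx, rfl⟩ := hg
    exact Subgroup.subset_closure
      ⟨e * f, mul_mem he hf, h, i, j, hi, hj, hx, by group⟩
  | one => simp
  | mul a b _ _ ha hb =>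
    have := mul_mem ha hb
    rwa [show e * a * e⁻¹ * (e * b * e⁻¹) = e * (a * b) * e⁻¹ by group] at this
  | inv a _ ha =>
    have := inv_mem ha
    rwa [show (e * a * e⁻¹)⁻¹ = e * a⁻¹ * e⁻¹ by group] at this

lemma commutator_mem_left {n : ℕ} {I : Ideal R} {e g : GL (Fin n) R} (he : e ∈ Elem n R)
    (hg : g ∈ ElemRel n R I) : ⁅e, g⁆ ∈ ElemRel n R I :=
  mul_mem (elemRel_conj he hg) (inv_mem hg)

lemma commutator_mem_right {n : ℕ} {I : Ideal R} {e g : GL (Fin n) R} (he : e ∈ Elem n R)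
    (hg : g ∈ ElemRel n R I) : ⁅g, e⁆ ∈ ElemRel n R I := by
  rw [← commutatorElement_inv]
  exact inv_mem (commutator_mem_left he hg)

lemma elemGL_commutator {n : ℕ} {i j k : Fin n} (hij : i ≠ j) (hjk : j ≠ k) (hik : i ≠ k)
    (a b : R) : ⁅elemGL i j hij a, elemGL j k hjk b⁆ = elemGL i k hik (a * b) := by
  rw [commutatorElement_def, mul_inv_eq_iff_eq_mul, mul_inv_eq_iff_eq_mul]
  ext1
  simp only [elemGL, Units.val_mul, transvection, mul_add, add_mul, one_mul, mul_one,
    single_mul_single_same, single_mul_single_of_ne _ _ _ _ hik.symm,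
    single_mul_single_of_ne _ _ _ _ hjk.symm, add_zero]
  abel

lemma elemGL_mem_elemRel {I : Ideal R} (i j : Fin 3) (h : i ≠ j) {x : R} (hx : x ∈ I) :
    elemGL i j h x ∈ ElemRel 3 R I := by
  have h10 : elemGL 1 0 (by decide) x ∈ ElemRel 3 R I :=
    Subgroup.subset_closure ⟨1, one_mem _, elemGL 1 0 (by decide) x, 1, 0, rfl, rfl,
      ⟨x, hx, rfl⟩, by simp⟩
  have left : ∀ (i j k : Fin 3) (hij : i ≠ j) (hjk : j ≠ k) (hik : i ≠ k),
      elemGL j k hjk x ∈ ElemRel 3 R I → elemGL i k hik x ∈ ElemRel 3 R I := by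
    intro i j k hij hjk hik hm
    have := commutator_mem_left (elemGL_mem i j hij 1) hm
    rwa [elemGL_commutator hij hjk hik, one_mul] at this
  have right : ∀ (i j k : Fin 3) (hij : i ≠ j) (hjk : j ≠ k) (hik : i ≠ k),
      elemGL i j hij x ∈ ElemRel 3 R I → elemGL i k hik x ∈ ElemRel 3 R I := by
    intro i j k hij hjk hik hm
    have := commutator_mem_right (elemGL_mem j k hjk 1) hm
    rwa [elemGL_commutator hij hjk hik, mul_one] at this
  have h20 := left 2 1 0 (by decide) (by decide) (by decide) h10
  have h12 := right 1 0 2 (by decide) (by decide) (by decide) h10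
  have h02 := left 0 1 2 (by decide) (by decide) (by decide) h12
  have h21 := right 2 0 1 (by decide) (by decide) (by decide) h20
  have h01 := left 0 2 1 (by decide) (by decide) (by decide) h21
  fin_cases i <;> fin_cases j <;> first | exact absurd rfl h | assumption

/-- Congruence of elements of `E_n(R)` modulo `E_n(R, I)`. -/
def Cong {n : ℕ} (I : Ideal R) (a b : GL (Fin n) R) : Prop :=
  a ∈ Elem n R ∧ b ∈ Elem n R ∧ a⁻¹ * b ∈ ElemRel n R I

lemma Cong.mul {n : ℕ} {I : Ideal R} {a b a' b' : GL (Fin n) R} (h : Cong I a b)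
    (h' : Cong I a' b') : Cong I (a * a') (b * b') := by
  refine ⟨mul_mem h.1 h'.1, mul_mem h.2.1 h'.2.1, ?_⟩
  have := mul_mem (elemRel_conj (inv_mem h'.1) h.2.2) h'.2.2
  rwa [show a'⁻¹ * (a⁻¹ * b) * a'⁻¹⁻¹ * (a'⁻¹ * b') = (a * a')⁻¹ * (b * b') by group] at this

lemma Cong.inv {n : ℕ} {I : Ideal R} {a b : GL (Fin n) R} (h : Cong I a b) :
    Cong I a⁻¹ b⁻¹ := by
  refine ⟨inv_mem h.1, inv_mem h.2.1, ?_⟩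
  have := elemRel_conj h.1 (inv_mem h.2.2)
  rwa [show a * (a⁻¹ * b)⁻¹ * a⁻¹ = a⁻¹⁻¹ * b⁻¹ by group] at this

lemma Cong.commutator {n : ℕ} {I : Ideal R} {a b a' b' : GL (Fin n) R} (h : Cong I a b)
    (h' : Cong I a' b') : Cong I ⁅a, a'⁆ ⁅b, b'⁆ :=
  ((h.mul h').mul h.inv).mul h'.inv

lemma cong_one {n : ℕ} (I : Ideal R) : Cong I (1 : GL (Fin n) R) 1 :=
  ⟨one_mem _, one_mem _, by simp⟩

lemma cong_elemGL {I : Ideal R} (i j : Fin 3) (h : i ≠ j) {a b : R}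
    (hab : Ideal.Quotient.mk I a = Ideal.Quotient.mk I b) :
    Cong I (elemGL i j h a) (elemGL i j h b) := by
  refine ⟨elemGL_mem i j h a, elemGL_mem i j h b, ?_⟩
  rw [← elemGL_neg, ← elemGL_add]
  refine elemGL_mem_elemRel _ _ _ ?_
  rw [neg_add_eq_sub]
  exact Ideal.Quotient.eq.mp hab.symm

/-- An elementary factorization of `1 + t • wᵀ * y`, where `y` is the row with entries
`0, w k, -w j` at the places `i, j, k`. -/
def shear (i j k : Fin 3) (hij : i ≠ j) (hik : i ≠ k) (t : R) (w : Fin 3 → R) :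
    GL (Fin 3) R :=
  ⁅elemGL j i hij.symm (w j) * elemGL k i hik.symm (w k),
    elemGL i j hij (t * w k) * elemGL i k hik (-(t * w j))⁆ *
    (elemGL i j hij (t * w i * w k) * elemGL i k hik (-(t * w i * w j)))

lemma cong_shear {I : Ideal R} (i j k : Fin 3) (hij : i ≠ j) (hik : i ≠ k) {t t' : R}
    {w w' : Fin 3 → R} (ht : Ideal.Quotient.mk I t = Ideal.Quotient.mk I t')
    (hw : ∀ l, Ideal.Quotient.mk I (w l) = Ideal.Quotient.mk I (w' l)) :
    Cong I (shear i j k hij hik t w) (shear i j k hij hik t' w') := by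
  refine (Cong.commutator ?_ ?_).mul ?_ <;> refine Cong.mul ?_ ?_ <;>
    refine cong_elemGL _ _ _ ?_ <;> simp only [map_mul, map_neg, ht, hw]

lemma shear_zero (i j k : Fin 3) (hij : i ≠ j) (hik : i ≠ k) (w : Fin 3 → R) :
    shear i j k hij hik 0 w = 1 := by
  simp [shear, elemGL_zero]

/-- The row with entries `0, w k, -w j` at the places `i, j, k`. -/
def perp (j k : Fin 3) (w : Fin 3 → R) : Fin 3 → R :=
  Pi.single j (w k) - Pi.single k (w j)

lemma coe_commutator_mul {S : Type*} [Ring S] {p q r : Sˣ} {a b c : S} (hp : (p : S) = 1 + a)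
    (hq : (q : S) = 1 + b) (hr : (r : S) = 1 + c) (haa : a * a = 0) (hbb : b * b = 0)
    (hba : b * a = 0) (hbc : b * c = 0) : ((⁅p, q⁆ * r : Sˣ) : S) = 1 + (a * b + c) := by
  have hp' : ((p⁻¹ : Sˣ) : S) = 1 - a :=
    Units.inv_eq_of_mul_eq_one_right (by rw [hp]; simp [add_mul, mul_sub, haa])
  have hq' : ((q⁻¹ : Sˣ) : S) = 1 - b :=
    Units.inv_eq_of_mul_eq_one_right (by rw [hq]; simp [add_mul, mul_sub, hbb])
  rw [commutatorElement_def]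
  simp only [Units.val_mul, hp, hq, hr, hp', hq']
  have hbb' : a * b * b = 0 := by rw [mul_assoc, hbb, mul_zero]
  have hba' : a * b * a = 0 := by rw [mul_assoc, hba, mul_zero]
  have hbc' : a * b * c = 0 := by rw [mul_assoc, hbc, mul_zero]
  simp only [add_mul, mul_add, mul_sub, sub_mul, mul_one, one_mul, haa, hbb, hba, hbc,
    hbb', hba', hbc', zero_mul]
  abel

lemma coe_shear (i j k : Fin 3) (hij : i ≠ j) (hik : i ≠ k) (hjk : j ≠ k) (t : R)
    (w : Fin 3 → R) :
    (shear i j k hij hik t w : Matrix (Fin 3) (Fin 3) R) =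
      1 + t • vecMulVec w (perp j k w) := by
  rw [shear, coe_commutator_mul (a := single j i (w j) + single k i (w k))
    (b := single i j (t * w k) + single i k (-(t * w j)))
    (c := single i j (t * w i * w k) + single i k (-(t * w i * w j)))]
  · congr 1
    simp only [add_mul, mul_add, single_mul_single_same, perp]
    ext a b
    have ha : a = i ∨ a = j ∨ a = k := by lia
    have hb : b = i ∨ b = j ∨ b = k := by lia
    rcases ha with rfl | rfl | rfl <;> rcases hb with rfl | rfl | rfl <;>
      simp [vecMulVec_apply, hij, hik, hjk, hij.symm, hik.symm, hjk.symm] <;> ring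
  all_goals
    simp only [elemGL, transvection, Units.val_mul, add_mul, mul_add, one_mul, mul_one,
      single_mul_single_same, single_mul_single_of_ne _ _ _ _ hij,
      single_mul_single_of_ne _ _ _ _ hik, single_mul_single_of_ne _ _ _ _ hij.symm,
      single_mul_single_of_ne _ _ _ _ hik.symm, add_zero]
  · abel
  · abel
  · abel
  · rw [single_mul_single_of_ne _ _ _ _ hjk, single_mul_single_of_ne _ _ _ _ hjk.symm, add_zero,
      zero_add, ← single_add,
      show t * w k * w j + -(t * w j) * w k = 0 by ring, single_zero]

lemma shear_neg (i j k : Fin 3) (hij : i ≠ j) (hik : i ≠ k) (hjk : j ≠ k) (t : R)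
    (w : Fin 3 → R) : shear i j k hij hik (-t) w = (shear i j k hij hik t w)⁻¹ := by
  rw [eq_inv_iff_mul_eq_one]
  ext1
  have : perp j k w ⬝ᵥ w = 0 := by
    simp [perp, sub_dotProduct, single_dotProduct, mul_comm]
  rw [Units.val_mul, coe_shear _ _ _ _ _ hjk, coe_shear _ _ _ _ _ hjk]
  simp [mul_add, add_mul, vecMulVec_mul_vecMulVec, this]

lemma vecMul_shear (i j k : Fin 3) (hij : i ≠ j) (hik : i ≠ k) (hjk : j ≠ k) (t : R)
    (u w : Fin 3 → R) (h : u ⬝ᵥ w = 1) :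
    u ᵥ* (shear i j k hij hik t w : Matrix (Fin 3) (Fin 3) R) = u + t • perp j k w := by
  rw [coe_shear _ _ _ _ _ hjk, vecMul_add, vecMul_one, vecMul_smul, vecMul_vecMulVec, h,
    one_smul]

/-- The congruence action of the general linear group on matrices. -/
def act {n : ℕ} (h : GL (Fin n) R) (V : Matrix (Fin n) (Fin n) R) : Matrix (Fin n) (Fin n) R :=
  (h : Matrix (Fin n) (Fin n) R)ᵀ * V * h

lemma act_one {n : ℕ} (V : Matrix (Fin n) (Fin n) R) : act 1 V = V := by simp [act]

lemma act_mul {n : ℕ} (g h : GL (Fin n) R) (V : Matrix (Fin n) (Fin n) R) :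
    act (g * h) V = act h (act g V) := by
  simp [act, Matrix.mul_assoc]

lemma act_elemGL_apply {n : ℕ} (i j : Fin n) (h : i ≠ j) (t : R) (V : Matrix (Fin n) (Fin n) R)
    (hV : V i i = 0) (a b : Fin n) :
    act (elemGL i j h t) V a b =
      V a b + (if b = j then t * V a i else 0) + (if a = j then t * V i b else 0) := by
  have h1 : ∀ (W : Matrix (Fin n) (Fin n) R) (a b : Fin n),
      (W * transvection i j t) a b = W a b + if b = j then t * W a i else 0 := by
    intro W a b
    split_ifs with hb
    · rw [hb, mul_transvection_apply_same]
    · rw [mul_transvection_apply_of_ne _ _ _ _ hb, add_zero]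
  have h2 : ∀ a b, ((transvection i j t)ᵀ * V) a b = V a b + if a = j then t * V i b else 0 := by
    intro a b
    have := h1 Vᵀ b a
    rwa [← transpose_apply (Vᵀ * _), transpose_mul, transpose_transpose] at this
  change ((transvection i j t)ᵀ * V * transvection i j t) a b = _
  rw [h1, h2, h2, hV]
  split_ifs <;> ring

/-- The first row of a `4 × 4` alternating matrix, without its diagonal entry. -/
def row (V : Matrix (Fin 4) (Fin 4) R) : Fin 3 → R := fun k => V 0 k.succ

/-- The row complementary to `row V` in the Pfaffian of `V`. -/
def corow (V : Matrix (Fin 4) (Fin 4) R) : Fin 3 → R := ![V 2 3, V 3 1, V 1 2]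

/-- Alternating `4 × 4` matrices with Pfaffian `1`. -/
structure IsUnitAlt (V : Matrix (Fin 4) (Fin 4) R) : Prop where
  diag : ∀ a, V a a = 0
  skew : ∀ a b, V a b = -V b a
  pf : row V ⬝ᵥ corow V = 1

lemma IsUnitAlt.act_elemGL {V : Matrix (Fin 4) (Fin 4) R} (hV : IsUnitAlt V) (i j : Fin 4)
    (h : i ≠ j) (t : R) : IsUnitAlt (act (elemGL i j h t) V) where
  diag a := by
    rw [act_elemGL_apply _ _ _ _ _ (hV.diag i), hV.diag, hV.skew i a]
    split_ifs <;> ring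
  skew a b := by
    simp only [act_elemGL_apply _ _ _ _ _ (hV.diag i)]
    rw [hV.skew a b, hV.skew i b, hV.skew i a]
    split_ifs <;> ring
  pf := by
    have hpf := hV.pf
    simp only [dotProduct, Fin.sum_univ_three, row, corow] at hpf ⊢
    rw [← hpf]
    simp only [act_elemGL_apply _ _ _ _ _ (hV.diag i)]
    have h10 := hV.skew 1 0
    have h20 := hV.skew 2 0
    have h30 := hV.skew 3 0
    have h21 := hV.skew 2 1
    have h31 := hV.skew 3 1
    have h32 := hV.skew 3 2
    fin_cases i <;> fin_cases j <;> first
      | exact absurd rfl h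
      | (simp [hV.diag, h10, h20, h30, h21, h31, h32]; ring)

/-- The action of an elementary generator of `E_4(R)` on alternating matrices of Pfaffian `1`
changes the first row by an element of `E_3(R)` depending only on `corow V`, compatibly with
congruences modulo `I`. -/
lemma exists_cocycle (I : Ideal R) (i j : Fin 4) (h : i ≠ j) :
    ∃ c : R → (Fin 3 → R) → GL (Fin 3) R,
      (∀ t t' w w', Ideal.Quotient.mk I t = Ideal.Quotient.mk I t' →
        (∀ l, Ideal.Quotient.mk I (w l) = Ideal.Quotient.mk I (w' l)) →
        Cong I (c t w) (c t' w')) ∧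
      (∀ w, c 0 w = 1) ∧
      ∀ t V, IsUnitAlt V →
        row (act (elemGL i j h t) V) = row V ᵥ* (c t (corow V) : Matrix (Fin 3) (Fin 3) R) ∧
        c (-t) (corow (act (elemGL i j h t) V)) = (c t (corow V))⁻¹ := by
  obtain rfl | ⟨i, rfl⟩ := i.eq_zero_or_eq_succ
  · refine ⟨fun _ _ => 1, fun _ _ _ _ _ _ => cong_one I, fun _ => rfl, fun t V hV => ⟨?_, ?_⟩⟩
    · ext k
      simp [row, act_elemGL_apply _ _ _ _ _ (hV.diag 0), hV.diag, h]
    · simp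
  obtain rfl | ⟨j, rfl⟩ := j.eq_zero_or_eq_succ
  · have h1 : i ≠ i + 1 := by lia
    have h2 : i ≠ i + 2 := by lia
    have h3 : i + 1 ≠ i + 2 := by lia
    refine ⟨shear i (i + 1) (i + 2) h1 h2, fun _ _ _ _ => cong_shear _ _ _ _ _,
      fun w => shear_zero .., fun t V hV => ⟨?_, ?_⟩⟩
    · rw [vecMul_shear _ _ _ _ _ h3 _ _ _ hV.pf]
      have h31 := hV.skew 3 1
      have h21 := hV.skew 2 1
      have h32 := hV.skew 3 2
      ext k
      fin_cases i <;> fin_cases k <;>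
        simp [row, corow, perp, act_elemGL_apply _ _ _ _ _ (hV.diag _), hV.diag, h31, h21, h32]
    · rw [← shear_neg _ _ _ _ _ h3]
      congr 1
      simp [corow, act_elemGL_apply _ _ _ _ _ (hV.diag _)]
  · have h' : i ≠ j := fun e => h (congrArg _ e)
    refine ⟨fun t _ => elemGL i j h' t, fun _ _ _ _ ht _ => cong_elemGL _ _ _ ht,
      fun w => elemGL_zero .., fun t V hV => ⟨?_, elemGL_neg ..⟩⟩
    ext k
    change _ = (row V ᵥ* transvection i j t) k
    rw [transvection, vecMul_add, vecMul_one]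
    simp [row, act_elemGL_apply _ _ _ _ _ (hV.diag _), (Fin.succ_ne_zero j).symm, vecMul,
      dotProduct, single_apply, ite_and, mul_comm, eq_comm]

/-- Elements of `GL_4(R)`, congruent to `1` modulo `I`, under whose action the first row of any
alternating matrix of Pfaffian `1` changes only by an element of `E_3(R, I)`. -/
structure MovesRow (I : Ideal R) (h : GL (Fin 4) R) : Prop where
  unitAlt : ∀ V, IsUnitAlt V ↔ IsUnitAlt (act h V)
  map_eq : GeneralLinearGroup.map (Ideal.Quotient.mk I) h = 1
  row_act : ∀ V, IsUnitAlt V →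
    ∃ δ ∈ ElemRel 3 R I, row (act h V) = row V ᵥ* (δ : Matrix (Fin 3) (Fin 3) R)

lemma isUnitAlt_act_elemGL_iff (i j : Fin 4) (h : i ≠ j) (t : R)
    (V : Matrix (Fin 4) (Fin 4) R) : IsUnitAlt V ↔ IsUnitAlt (act (elemGL i j h t) V) := by
  refine ⟨fun hV => hV.act_elemGL i j h t, fun hV => ?_⟩
  have := hV.act_elemGL i j h (-t)
  rwa [← act_mul, elemGL_neg, mul_inv_cancel, act_one] at this

lemma MovesRow.one (I : Ideal R) : MovesRow I (1 : GL (Fin 4) R) where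
  unitAlt V := by rw [act_one]
  map_eq := map_one _
  row_act V _ := ⟨1, one_mem _, by simp [act_one]⟩

lemma MovesRow.mul {I : Ideal R} {g h : GL (Fin 4) R} (hg : MovesRow I g) (hh : MovesRow I h) :
    MovesRow I (g * h) where
  unitAlt V := by rw [act_mul, ← hh.unitAlt, ← hg.unitAlt]
  map_eq := by rw [map_mul, hg.map_eq, hh.map_eq, one_mul]
  row_act V hV := by
    obtain ⟨δ, hδ, e⟩ := hg.row_act V hV
    obtain ⟨δ', hδ', e'⟩ := hh.row_act _ ((hg.unitAlt V).1 hV)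
    exact ⟨δ * δ', mul_mem hδ hδ', by rw [act_mul, e', e, vecMul_vecMul, Units.val_mul]⟩

lemma MovesRow.inv {I : Ideal R} {h : GL (Fin 4) R} (hh : MovesRow I h) : MovesRow I h⁻¹ where
  unitAlt V := by rw [hh.unitAlt (act h⁻¹ V), ← act_mul, inv_mul_cancel, act_one]
  map_eq := by rw [map_inv, hh.map_eq, inv_one]
  row_act V hV := by
    have hW : act h (act h⁻¹ V) = V := by rw [← act_mul, inv_mul_cancel, act_one]
    obtain ⟨δ, hδ, e⟩ := hh.row_act (act h⁻¹ V) ((hh.unitAlt _).2 (by rwa [hW]))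
    refine ⟨δ⁻¹, inv_mem hδ, ?_⟩
    rw [hW] at e
    rw [e, vecMul_vecMul, ← Units.val_mul, mul_inv_cancel, Units.val_one, vecMul_one]

lemma map_act {I : Ideal R} {h : GL (Fin 4) R}
    (hh : GeneralLinearGroup.map (Ideal.Quotient.mk I) h = 1) (V : Matrix (Fin 4) (Fin 4) R) :
    (act h V).map (Ideal.Quotient.mk I) = V.map (Ideal.Quotient.mk I) := by
  have : (h : Matrix (Fin 4) (Fin 4) R).map (Ideal.Quotient.mk I) = 1 :=
    congrArg Units.val hh
  rw [act, Matrix.map_mul, Matrix.map_mul, transpose_map, this, transpose_one, one_mul, mul_one]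

lemma MovesRow.elemGL_conj {I : Ideal R} {h : GL (Fin 4) R} (hh : MovesRow I h) (i j : Fin 4)
    (hij : i ≠ j) (t : R) : MovesRow I (elemGL i j hij t * h * (elemGL i j hij t)⁻¹) where
  unitAlt V := by
    rw [act_mul, act_mul, ← elemGL_neg, ← isUnitAlt_act_elemGL_iff, ← hh.unitAlt,
      ← isUnitAlt_act_elemGL_iff]
  map_eq := by simp [hh.map_eq]
  row_act V hV := by
    obtain ⟨c, hc, -, hrow⟩ := exists_cocycle I i j hij
    obtain ⟨e₁, e₁'⟩ := hrow t V hV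
    set V₁ := act (elemGL i j hij t) V
    have hV₁ : IsUnitAlt V₁ := hV.act_elemGL i j hij t
    obtain ⟨δ, hδ, e₂⟩ := hh.row_act V₁ hV₁
    have hV₂ := (hh.unitAlt V₁).1 hV₁
    have e₃ := (hrow (-t) _ hV₂).1
    have hcong : Cong I (c (-t) (corow V₁)) (c (-t) (corow (act h V₁))) := by
      refine hc _ _ _ _ rfl fun l => ?_
      have := fun a b => congrFun (congrFun (map_act hh.map_eq V₁) a) b
      simp only [map_apply] at this
      fin_cases l <;> simp [corow, this]
    rw [e₁'] at hcong
    have hcE : c t (corow V) ∈ Elem 3 R := by simpa using hcong.1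
    refine ⟨_, mul_mem (elemRel_conj hcE hδ) hcong.2.2, ?_⟩
    rw [act_mul, act_mul, ← elemGL_neg, e₃, e₂, e₁, vecMul_vecMul, vecMul_vecMul,
      ← Units.val_mul, ← Units.val_mul]
    congr 2
    group

lemma movesRow_conj_iff {I : Ideal R} {e : GL (Fin 4) R} (he : e ∈ Elem 4 R) :
    ∀ h, MovesRow I h ↔ MovesRow I (e * h * e⁻¹) := by
  induction he using Subgroup.closure_induction with
  | mem e he =>
    obtain ⟨i, j, hij, t, he⟩ := he
    obtain rfl := eq_elemGL hij he
    refine fun h => ⟨fun hh => hh.elemGL_conj i j hij t, fun hh => ?_⟩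
    have := hh.elemGL_conj i j hij (-t)
    rw [elemGL_neg] at this
    simpa [mul_assoc] using this
  | one => simp
  | mul a b _ _ ha hb =>
    intro h
    rw [hb h, ha]
    simp [mul_assoc]
  | inv a _ ha =>
    intro h
    rw [ha (a⁻¹ * h * a⁻¹⁻¹)]
    simp [mul_assoc]

lemma movesRow_elemGL {I : Ideal R} (i j : Fin 4) (hij : i ≠ j) {x : R} (hx : x ∈ I) :
    MovesRow I (elemGL i j hij x) where
  unitAlt V := isUnitAlt_act_elemGL_iff ..
  map_eq := by
    have : GeneralLinearGroup.map (Ideal.Quotient.mk I) (elemGL i j hij x) =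
        elemGL i j hij (Ideal.Quotient.mk I x) := by
      ext1
      change (transvection i j x).map (Ideal.Quotient.mk I) = transvection i j _
      simp [transvection, Matrix.map_add]
    rw [this, Ideal.Quotient.eq_zero_iff_mem.2 hx, elemGL_zero]
  row_act V hV := by
    obtain ⟨c, hc, hc0, hrow⟩ := exists_cocycle I i j hij
    refine ⟨c x (corow V), ?_, (hrow x V hV).1⟩
    have := (hc 0 x (corow V) (corow V)
      (by rw [map_zero, Ideal.Quotient.eq_zero_iff_mem.2 hx]) fun _ => rfl).2.2
    rwa [hc0, inv_one, one_mul] at this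

lemma movesRow_of_mem_elemRel {I : Ideal R} {g : GL (Fin 4) R} (hg : g ∈ ElemRel 4 R I) :
    MovesRow I g := by
  induction hg using Subgroup.closure_induction with
  | mem g hg =>
    obtain ⟨e, he, h, i, j, hi, hj, ⟨x, hx, hh⟩, rfl⟩ := hg
    have hij : i ≠ j := by rintro rfl; lia
    obtain rfl := eq_elemGL hij hh
    exact (movesRow_conj_iff he _).1 (movesRow_elemGL i j hij hx)
  | one => exact .one I
  | mul _ _ _ _ ha hb => exact ha.mul hb
  | inv _ _ ha => exact ha.inv

end RelElem

/-- if `u, v ∈ Um₃(R, I)`, `α ∈ SL₃(R)` with `α ≡ I₃ mod I`,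
`u·α = v`, and `diag(1, α) ∈ E₄(R, I)`, then `u` and `v` are elementarily
equivalent relative to `I`. -/
theorem relatively_equivalent_of_stably_relative_elementary
    (R : Type*) [CommRing R] (I : Ideal R)
    (u v : Fin 3 → R)
    (hu : u ∈ UmRel 3 R I) (hv : v ∈ UmRel 3 R I)
    (α : Matrix (Fin 3) (Fin 3) R)
    (hdet : α.det = 1)
    (hαI : ∀ i j, α i j - (1 : Matrix (Fin 3) (Fin 3) R) i j ∈ I)
    (huv : Matrix.vecMul u α = v)
    (hE : ∃ g ∈ ElemRel 4 R I,
      (g : Matrix (Fin 4) (Fin 4) R) =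
        Matrix.reindex finSumFinEquiv finSumFinEquiv
          (Matrix.fromBlocks (1 : Matrix (Fin 1) (Fin 1) R) 0 0 α)) :
    ∃ ε ∈ ElemRel 3 R I,
      Matrix.vecMul u (ε : Matrix (Fin 3) (Fin 3) R) = v := by
  obtain ⟨g, hg, hgα⟩ := hE
  obtain ⟨w, hw⟩ := hu.1
  let V : Matrix (Fin 4) (Fin 4) R :=
    !![0, u 0, u 1, u 2; -u 0, 0, w 2, -w 1; -u 1, -w 2, 0, w 0; -u 2, w 1, -w 0, 0]
  have hV : RelElem.IsUnitAlt V := by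
    refine ⟨fun a => ?_, fun a b => ?_, ?_⟩
    · fin_cases a <;> rfl
    · fin_cases a <;> fin_cases b <;> simp [V]
    · rw [← hw]
      simp [dotProduct, Fin.sum_univ_three, RelElem.row, RelElem.corow, V]
  have hrow : RelElem.row V = u := by
    ext k
    fin_cases k <;> rfl
  obtain ⟨δ, hδ, e⟩ := (RelElem.movesRow_of_mem_elemRel hg).row_act V hV
  refine ⟨δ, hδ, ?_⟩
  rw [← hrow, ← e, ← huv]
  have hg' : (g : Matrix (Fin 4) (Fin 4) R) =
      !![1, 0, 0, 0; 0, α 0 0, α 0 1, α 0 2; 0, α 1 0, α 1 1, α 1 2; 0, α 2 0, α 2 1, α 2 2] := by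
    rw [hgα]
    ext a b
    fin_cases a <;> fin_cases b <;> rfl
  ext k
  fin_cases k <;>
    simp [RelElem.row, RelElem.act, hg', Matrix.mul_apply, Fin.sum_univ_four, V, vecMul,
      dotProduct, Fin.sum_univ_three]
end

section
/- Let R be a commutative ring, n ≥ 3, and suppose the stable range condition Sr_m(R) holds for some m ≤ 2n − 2 (e.g. R has stable dimension d with d ≤ 2n − 3). Let I be an ideal of R and let v, w ∈ Um_n(R, I). Then there exist ε_1, ε_2 ∈ E_n(R, I) and elements a_1, …, a_{n−1}, a, b ∈ R such that v·ε_1 = (a_1, …, a_{n−1}, a), w·ε_2 = (a_1, …, a_{n−1}, b), and the image of a + b is a unit in R/(a_1, …, a_{n−1}). -/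
open Matrix

/-- The stable range condition `Sr_n(J)`: for every `(a₁, …, a_{n+1}) ∈ Um_{n+1}(R, J)`
there are `c₁, …, c_n ∈ J` with `(a₁ + c₁·a_{n+1}, …, a_n + c_n·a_{n+1}) ∈ Um_n(R, J)`. -/
def SrCond (n : ℕ) (R : Type*) [CommRing R] (J : Ideal R) : Prop :=
  ∀ a : Fin (n + 1) → R, a ∈ UmRel (n + 1) R J →
    ∃ c : Fin n → R, (∀ i, c i ∈ J) ∧
      (fun i : Fin n => a i.castSucc + c i * a (Fin.last n)) ∈ UmRel n R J

/-- Version of the stable range condition for rows indexed by an arbitrary finite type. -/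
def StableRangeOn (ι : Type*) [Fintype ι] (R : Type*) [CommRing R] : Prop :=
  ∀ (a : ι → R) (x : R), (∃ (p : ι → R) (q : R), ∑ i, a i * p i + x * q = 1) →
    ∃ c p : ι → R, ∑ i, (a i + c i * x) * p i = 1

theorem SrCond.stableRangeOn {R : Type*} [CommRing R] {n : ℕ} (h : SrCond n R ⊤) :
    StableRangeOn (Fin n) R := by
  rintro a x ⟨p, q, hpq⟩
  obtain ⟨c, -, ⟨p', hp'⟩, -⟩ := h (Fin.snoc a x)
    ⟨⟨Fin.snoc p q, by simpa [Fin.sum_univ_castSucc] using hpq⟩, by simp⟩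
  exact ⟨c, p', by simpa using hp'⟩

theorem StableRangeOn.fin_succ {R : Type*} [CommRing R] {n : ℕ}
    (h : StableRangeOn (Fin n) R) : StableRangeOn (Fin (n + 1)) R := by
  rintro a x ⟨p, q, hpq⟩
  rw [Fin.sum_univ_castSucc] at hpq
  obtain ⟨c, r, hr⟩ := h (fun i => a i.castSucc)
    (a (Fin.last n) * p (Fin.last n) + x * q)
    ⟨fun i => p i.castSucc, 1, by linear_combination hpq⟩
  refine ⟨Fin.snoc (fun i => c i * q) 0,
    Fin.snoc r (p (Fin.last n) * ∑ i, c i * r i), ?_⟩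
  rw [← hr]
  simp only [Fin.sum_univ_castSucc, Fin.snoc_castSucc, Fin.snoc_last, Finset.mul_sum,
    ← Finset.sum_add_distrib]
  exact Finset.sum_congr rfl fun i _ => by ring

theorem StableRangeOn.fin_of_le {R : Type*} [CommRing R] {m n : ℕ} (hmn : m ≤ n)
    (h : StableRangeOn (Fin m) R) : StableRangeOn (Fin n) R := by
  induction n, hmn using Nat.le_induction with
  | base => exact h
  | succ k _ ih => exact ih.fin_succ

theorem StableRangeOn.of_equiv {R ι κ : Type*} [CommRing R] [Fintype ι] [Fintype κ]
    (e : ι ≃ κ) (h : StableRangeOn ι R) : StableRangeOn κ R := by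
  rintro a x ⟨p, q, hpq⟩
  obtain ⟨c, r, hr⟩ := h (a ∘ e) x ⟨p ∘ e, q, by
    rw [← hpq, ← e.sum_comp]; rfl⟩
  refine ⟨c ∘ e.symm, r ∘ e.symm, ?_⟩
  rw [← hr, ← e.sum_comp]
  simp

/-- The transvection `1 + c·e_{ij}` as an element of the general linear group. -/
def transvectionGL {n : ℕ} {R : Type*} [CommRing R] {i j : Fin n} (hij : i ≠ j) (c : R) :
    GL (Fin n) R where
  val := Matrix.transvection i j c
  inv := Matrix.transvection i j (-c)
  val_inv := by simp [Matrix.transvection_mul_transvection_same _ _ hij]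
  inv_val := by simp [Matrix.transvection_mul_transvection_same _ _ hij]

theorem coe_transvectionGL {n : ℕ} {R : Type*} [CommRing R] {i j : Fin n} (hij : i ≠ j) (c : R) :
    (transvectionGL hij c : Matrix (Fin n) (Fin n) R) = Matrix.transvection i j c := rfl

theorem transvectionGL_inv {n : ℕ} {R : Type*} [CommRing R] {i j : Fin n} (hij : i ≠ j) (c : R) :
    (transvectionGL hij c)⁻¹ = transvectionGL hij (-c) :=
  Units.ext rfl

theorem transvectionGL_mem_Elem {n : ℕ} {R : Type*} [CommRing R] {i j : Fin n} (hij : i ≠ j)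
    (c : R) : transvectionGL hij c ∈ Elem n R :=
  Subgroup.subset_closure ⟨i, j, hij, c, rfl⟩

theorem ElemRel.conj_mem {n : ℕ} {R : Type*} [CommRing R] {I : Ideal R} {e g : GL (Fin n) R}
    (he : e ∈ Elem n R) (hg : g ∈ ElemRel n R I) : e * g * e⁻¹ ∈ ElemRel n R I := by
  induction hg using Subgroup.closure_induction with
  | mem x hx =>
    obtain ⟨e', he', h, i, j, hi, hj, hx, rfl⟩ := hx
    exact Subgroup.subset_closure
      ⟨e * e', mul_mem he he', h, i, j, hi, hj, hx, by group⟩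
  | one => simp
  | mul x y _ _ hx hy =>
    have : e * (x * y) * e⁻¹ = (e * x * e⁻¹) * (e * y * e⁻¹) := by group
    exact this ▸ mul_mem hx hy
  | inv x _ hx =>
    have : e * x⁻¹ * e⁻¹ = (e * x * e⁻¹)⁻¹ := by group
    exact this ▸ inv_mem hx

theorem transvectionGL_eq_commutator {n : ℕ} {R : Type*} [CommRing R] {i j k : Fin n}
    (hij : i ≠ j) (hjk : j ≠ k) (hik : i ≠ k) (c d : R) :
    transvectionGL hik (c * d) =
      transvectionGL hij c * transvectionGL hjk d * (transvectionGL hij c)⁻¹ *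
        (transvectionGL hjk d)⁻¹ := by
  rw [transvectionGL_inv, transvectionGL_inv]
  ext1
  simp only [Units.val_mul, coe_transvectionGL, Matrix.transvection, mul_add, add_mul, mul_one,
    one_mul, Matrix.single_mul_single_same, Matrix.single_mul_single_of_ne _ _ _ _ hij.symm,
    Matrix.single_mul_single_of_ne _ _ _ _ hjk.symm, Matrix.single_mul_single_of_ne _ _ _ _ hik.symm]
  simp [← Matrix.single_neg]
  abel

theorem transvectionGL_mem_ElemRel_left {n : ℕ} {R : Type*} [CommRing R] {I : Ideal R}
    {i j k : Fin n} (hij : i ≠ j) (hjk : j ≠ k) (hik : i ≠ k) {x : R}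
    (h : transvectionGL hij x ∈ ElemRel n R I) : transvectionGL hik x ∈ ElemRel n R I := by
  rw [← mul_one x, transvectionGL_eq_commutator hij hjk hik x 1, mul_assoc, mul_assoc,
    ← mul_assoc (transvectionGL hjk 1)]
  exact mul_mem h (ElemRel.conj_mem (transvectionGL_mem_Elem _ _) (inv_mem h))

theorem transvectionGL_mem_ElemRel_right {n : ℕ} {R : Type*} [CommRing R] {I : Ideal R}
    {i j k : Fin n} (hij : i ≠ j) (hjk : j ≠ k) (hik : i ≠ k) {x : R}
    (h : transvectionGL hjk x ∈ ElemRel n R I) : transvectionGL hik x ∈ ElemRel n R I := by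
  rw [← one_mul x, transvectionGL_eq_commutator hij hjk hik 1 x]
  exact mul_mem (ElemRel.conj_mem (transvectionGL_mem_Elem _ _) h) (inv_mem h)

theorem transvectionGL_mem_ElemRel {s : ℕ} {R : Type*} [CommRing R] {I : Ideal R}
    {i j : Fin (s + 3)} (hij : i ≠ j) {x : R} (hx : x ∈ I) :
    transvectionGL hij x ∈ ElemRel (s + 3) R I := by
  have h10 : (1 : Fin (s + 3)) ≠ 0 := by simp
  have base : transvectionGL h10 x ∈ ElemRel (s + 3) R I :=
    Subgroup.subset_closure ⟨1, one_mem _, transvectionGL h10 x, 1, 0, by simp, rfl,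
      ⟨x, hx, rfl⟩, by simp⟩
  have row (k : Fin (s + 3)) (hk : 1 ≠ k) : transvectionGL hk x ∈ ElemRel (s + 3) R I := by
    by_cases h : (0 : Fin (s + 3)) = k
    · subst h; exact base
    · exact transvectionGL_mem_ElemRel_left h10 h hk base
  have generic (i k : Fin (s + 3)) (hi : i ≠ 1) (hk : 1 ≠ k) (hik : i ≠ k) :
      transvectionGL hik x ∈ ElemRel (s + 3) R I :=
    transvectionGL_mem_ElemRel_right hi hk hik (row k hk)
  by_cases hi : i = 1
  · subst hi; exact row j hij
  by_cases hj : 1 = j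
  · subst hj
    obtain ⟨k, hk⟩ : ∃ k : Fin (s + 3), k ∉ ({i, 1} : Finset (Fin (s + 3))) := by
      by_contra! h
      have := Finset.card_le_card (fun k _ => h k : Finset.univ ⊆ _)
      have := Finset.card_le_two (a := i) (b := (1 : Fin (s + 3)))
      simp at *
      omega
    simp only [Finset.mem_insert, Finset.mem_singleton, not_or] at hk
    exact transvectionGL_mem_ElemRel_left (Ne.symm hk.1) hk.2 hij
      (generic i k hi (Ne.symm hk.2) (Ne.symm hk.1))
  · exact generic i j hi hj hij

/-- Two rows are related when they lie in one orbit of `E_n(R, I)`. -/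
def ElemRelOrbit {n : ℕ} {R : Type*} [CommRing R] (I : Ideal R) (v w : Fin n → R) : Prop :=
  ∃ ε ∈ ElemRel n R I, Matrix.vecMul v (ε : Matrix (Fin n) (Fin n) R) = w

theorem ElemRelOrbit.refl {n : ℕ} {R : Type*} [CommRing R] (I : Ideal R) (v : Fin n → R) :
    ElemRelOrbit I v v :=
  ⟨1, one_mem _, by simp⟩

theorem ElemRelOrbit.trans {n : ℕ} {R : Type*} [CommRing R] {I : Ideal R} {u v w : Fin n → R}
    (huv : ElemRelOrbit I u v) (hvw : ElemRelOrbit I v w) : ElemRelOrbit I u w := by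
  obtain ⟨e, he, rfl⟩ := huv
  obtain ⟨f, hf, rfl⟩ := hvw
  exact ⟨e * f, mul_mem he hf, by simp [Matrix.vecMul_vecMul]⟩

theorem vecMul_transvection {n : ℕ} {R : Type*} [CommRing R] (v : Fin n → R) (i j : Fin n)
    (c : R) : Matrix.vecMul v (Matrix.transvection i j c) =
      Function.update v j (v j + c * v i) := by
  ext k
  rw [Matrix.transvection, Matrix.vecMul_add, Matrix.vecMul_one]
  by_cases hk : k = j
  · subst hk
    simp [Matrix.vecMul, dotProduct, Matrix.single_apply, mul_comm]
  · simp [Matrix.vecMul, dotProduct, hk, Ne.symm hk]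

theorem ElemRelOrbit.update {s : ℕ} {R : Type*} [CommRing R] {I : Ideal R}
    (v : Fin (s + 3) → R) {i j : Fin (s + 3)} (hij : i ≠ j) {c : R} (hc : c ∈ I) :
    ElemRelOrbit I v (Function.update v j (v j + c * v i)) :=
  ⟨transvectionGL hij c, transvectionGL_mem_ElemRel hij hc, vecMul_transvection v i j c⟩

theorem ElemRelOrbit.add_mul_last {s : ℕ} {R : Type*} [CommRing R] {I : Ideal R}
    (a : Fin (s + 2) → R) (x : R) {c : Fin (s + 2) → R} (hc : ∀ i, c i ∈ I) :
    ElemRelOrbit (n := s + 3) I (Fin.snoc a x) (Fin.snoc (fun i => a i + c i * x) x) := by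
  suffices h : ∀ S : Finset (Fin (s + 2)), ElemRelOrbit (n := s + 3) I (Fin.snoc a x)
      (Fin.snoc (fun i => a i + if i ∈ S then c i * x else 0) x) by
    simpa using h Finset.univ
  intro S
  induction S using Finset.induction_on with
  | empty => simpa using ElemRelOrbit.refl (n := s + 3) I (Fin.snoc a x)
  | insert k S hk ih =>
    refine ih.trans ?_
    convert ElemRelOrbit.update (I := I) _ (Fin.castSucc_lt_last k).ne' (hc k) using 1
    rw [← Fin.snoc_update]
    congr 1
    ext i
    by_cases hi : i = k
    · subst hi; simp [hk]
    · simp [hi]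

theorem ElemRelOrbit.last_add_sum {s : ℕ} {R : Type*} [CommRing R] {I : Ideal R}
    (a : Fin (s + 2) → R) (x : R) {c : Fin (s + 2) → R} (hc : ∀ i, c i ∈ I) :
    ElemRelOrbit (n := s + 3) I (Fin.snoc a x) (Fin.snoc a (x + ∑ i, c i * a i)) := by
  induction (Finset.univ : Finset (Fin (s + 2))) using Finset.induction_on with
  | empty => simpa using ElemRelOrbit.refl (n := s + 3) I (Fin.snoc a x)
  | insert k S hk ih =>
    refine ih.trans ?_
    convert ElemRelOrbit.update (I := I) _ (Fin.castSucc_lt_last k).ne (hc k) using 1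
    rw [Fin.snoc_last, Fin.snoc_castSucc, Fin.update_snoc_last, Finset.sum_insert hk,
      add_comm (c k * a k), add_assoc]

theorem ElemRelOrbit.sub_mul_zero_of_add_mul_zero {s : ℕ} {R : Type*} [CommRing R] {I : Ideal R}
    {a b : Fin (s + 2) → R} {x y : R} (l : R)
    (h : ElemRelOrbit (n := s + 3) I (Fin.snoc a (x + l * a 0)) (Fin.snoc b y)) :
    ElemRelOrbit (n := s + 3) I (Fin.snoc a x) (Fin.snoc b (y - l * b 0)) := by
  obtain ⟨e, he, heq⟩ := h
  have hne : Fin.castSucc (0 : Fin (s + 2)) ≠ Fin.last (s + 2) := (Fin.castSucc_lt_last 0).ne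
  refine ⟨_, ElemRel.conj_mem (transvectionGL_mem_Elem hne l) he, ?_⟩
  rw [transvectionGL_inv, Units.val_mul, Units.val_mul, coe_transvectionGL, coe_transvectionGL,
    ← Matrix.vecMul_vecMul, ← Matrix.vecMul_vecMul, vecMul_transvection (Fin.snoc a x)]
  have h1 : Function.update (Fin.snoc a x : Fin (s + 3) → R) (Fin.last (s + 2))
      ((Fin.snoc a x : Fin (s + 3) → R) (Fin.last (s + 2)) +
        l * (Fin.snoc a x : Fin (s + 3) → R) (Fin.castSucc 0)) = Fin.snoc a (x + l * a 0) := by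
    simp only [Fin.snoc_last, Fin.snoc_castSucc, Fin.update_snoc_last]
  rw [h1, heq, vecMul_transvection]
  simp only [Fin.snoc_last, Fin.snoc_castSucc, Fin.update_snoc_last]
  congr 1
  ring

theorem exists_elemRelOrbit_snoc {s : ℕ} {R : Type*} [CommRing R] {I : Ideal R}
    (hsr : StableRangeOn (Fin (s + 2) ⊕ Fin (s + 2)) R)
    {a b : Fin (s + 2) → R} {x y : R} (ha : a 0 - 1 ∈ I) (hab : ∀ i, a i - b i ∈ I)
    (hx : x ∈ I) (hy : y ∈ I)
    (hv : ∃ (p : Fin (s + 2) → R) (q : R), ∑ i, a i * p i + x * q = 1)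
    (hw : ∃ (p : Fin (s + 2) → R) (q : R), ∑ i, b i * p i + y * q = 1) :
    ∃ (d : Fin (s + 2) → R) (z z' : R),
      ElemRelOrbit (n := s + 3) I (Fin.snoc a x) (Fin.snoc d z) ∧
      ElemRelOrbit (n := s + 3) I (Fin.snoc b y) (Fin.snoc d z') ∧ z + z' = 1 - d 0 := by
  obtain ⟨p, q, hpq⟩ := hv
  obtain ⟨p', q', hpq'⟩ := hw
  obtain ⟨c, r, hr⟩ := hsr (Sum.elim a b) (x * y)
    ⟨Sum.elim p (fun i => x * q * p' i), q * q', by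
      have : ∑ i, b i * (x * q * p' i) = x * q * ∑ i, b i * p' i := by
        rw [Finset.mul_sum]; exact Finset.sum_congr rfl fun i _ => by ring
      simp only [Fintype.sum_sum_type, Sum.elim_inl, Sum.elim_inr, this]
      linear_combination hpq + x * q * hpq'⟩
  simp only [Fintype.sum_sum_type, Sum.elim_inl, Sum.elim_inr] at hr
  have hstep : ElemRelOrbit (n := s + 3) I (Fin.snoc a x)
      (Fin.snoc (fun i => a i + c (Sum.inl i) * (x * y)) x) := by
    convert ElemRelOrbit.add_mul_last a x (c := fun i => c (Sum.inl i) * y)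
      (fun i => I.mul_mem_left _ hy) using 3
    ring
  have hstep' : ElemRelOrbit (n := s + 3) I (Fin.snoc b y)
      (Fin.snoc (fun i => b i + c (Sum.inr i) * (x * y)) y) := by
    convert ElemRelOrbit.add_mul_last b y (c := fun i => c (Sum.inr i) * x)
      (fun i => I.mul_mem_left _ hx) using 3
    ring
  have hxy : x * y ∈ I := I.mul_mem_left _ hy
  set a₁ : Fin (s + 2) → R := fun i => a i + c (Sum.inl i) * (x * y) with ha₁
  set b₁ : Fin (s + 2) → R := fun i => b i + c (Sum.inr i) * (x * y) with hb₁
  have ha₁I : a₁ 0 - 1 ∈ I := by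
    have : a₁ 0 - 1 = (a 0 - 1) + c (Sum.inl 0) * (x * y) := by rw [ha₁]; ring
    exact this ▸ add_mem ha (I.mul_mem_left _ hxy)
  have habI (i : Fin (s + 2)) : a₁ i - b₁ i ∈ I := by
    have : a₁ i - b₁ i = (a i - b i) + (c (Sum.inl i) - c (Sum.inr i)) * (x * y) := by
      rw [ha₁, hb₁]; ring
    exact this ▸ add_mem (hab i) (I.mul_mem_left _ hxy)
  set t : R := 1 - (x + 1 * a₁ 0) - y with ht
  have htI : t ∈ I := by
    have : t = -(a₁ 0 - 1) - x - y := by rw [ht]; ring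
    exact this ▸ sub_mem (sub_mem (neg_mem ha₁I) hx) hy
  set x₂ : R := x + 1 * a₁ 0 + ∑ i, t * r (Sum.inl i) * a₁ i with hx₂
  set y₂ : R := y + ∑ i, t * r (Sum.inr i) * b₁ i with hy₂
  have hsum : x₂ + y₂ = 1 := by
    have h1 : ∑ i, t * r (Sum.inl i) * a₁ i = t * ∑ i, a₁ i * r (Sum.inl i) := by
      rw [Finset.mul_sum]; exact Finset.sum_congr rfl fun i _ => by ring
    have h2 : ∑ i, t * r (Sum.inr i) * b₁ i = t * ∑ i, b₁ i * r (Sum.inr i) := by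
      rw [Finset.mul_sum]; exact Finset.sum_congr rfl fun i _ => by ring
    have hr' : ∑ i, a₁ i * r (Sum.inl i) + ∑ i, b₁ i * r (Sum.inr i) = 1 := hr
    rw [hx₂, hy₂, h1, h2]
    linear_combination t * hr' + ht
  have hlast := (ElemRelOrbit.last_add_sum a₁ (x + 1 * a₁ 0) (I := I)
    (c := fun i => t * r (Sum.inl i)) (fun i => I.mul_mem_right _ htI)).trans
    (ElemRelOrbit.add_mul_last a₁ x₂ (c := fun i => -(a₁ i - b₁ i)) (fun i => neg_mem (habI i)))
  have hlast' := (ElemRelOrbit.last_add_sum b₁ y (I := I)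
    (c := fun i => t * r (Sum.inr i)) (fun i => I.mul_mem_right _ htI)).trans
    (ElemRelOrbit.add_mul_last b₁ y₂ (c := fun i => a₁ i - b₁ i) habI)
  have hd : (fun i => b₁ i + (a₁ i - b₁ i) * y₂) = fun i => a₁ i + -(a₁ i - b₁ i) * x₂ := by
    ext i
    linear_combination (a₁ i - b₁ i) * hsum
  rw [hd] at hlast'
  refine ⟨_, _, y₂, hstep.trans (hlast.sub_mul_zero_of_add_mul_zero 1), hstep'.trans hlast', ?_⟩
  linear_combination hsum

/-- relative Mennicke–Newman, last coordinate: `R` a commutative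
ring satisfying `Sr_t(R)` for some `1 ≤ t ≤ 2n − 2`, `n = s + 3 ≥ 3` (e.g. `R` of
stable dimension `d ≤ 2n − 3`), `I` an ideal, `v, w ∈ Um_n(R, I)`.  Then there
are `ε₁, ε₂ ∈ E_n(R, I)` such that `v·ε₁` and `w·ε₂` agree except possibly in
the last coordinate, where their last coordinates `a, b` satisfy: `a + b` is a
unit modulo the ideal generated by the remaining coordinates. -/
theorem relative_mennicke_newman_last
    (R : Type*) [CommRing R] (s : ℕ)
    (hsr : ∃ t : ℕ, t + 1 ≤ 2 * (s + 3) - 2 ∧ SrCond (t + 1) R (⊤ : Ideal R))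
    (I : Ideal R)
    (v w : Fin (s + 3) → R)
    (hv : v ∈ UmRel (s + 3) R I) (hw : w ∈ UmRel (s + 3) R I) :
    ∃ ε₁ ∈ ElemRel (s + 3) R I, ∃ ε₂ ∈ ElemRel (s + 3) R I, ∃ b : R,
      Matrix.vecMul w (ε₂ : Matrix (Fin (s + 3)) (Fin (s + 3)) R) =
        Function.update
          (Matrix.vecMul v (ε₁ : Matrix (Fin (s + 3)) (Fin (s + 3)) R))
          (Fin.last (s + 2)) b ∧
      IsUnit (Ideal.Quotient.mk
        (Ideal.span ((Matrix.vecMul v (ε₁ : Matrix (Fin (s + 3)) (Fin (s + 3)) R)) ''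
          {i : Fin (s + 3) | i ≠ Fin.last (s + 2)}))
        ((Matrix.vecMul v (ε₁ : Matrix (Fin (s + 3)) (Fin (s + 3)) R)) (Fin.last (s + 2)) + b)) := by
  obtain ⟨t, ht, hsr⟩ := hsr
  have hsr' : StableRangeOn (Fin (s + 2) ⊕ Fin (s + 2)) R :=
    (hsr.stableRangeOn.fin_of_le (n := (s + 2) + (s + 2)) (by omega)).of_equiv
      finSumFinEquiv.symm
  have unimodular (u : Fin (s + 3) → R) (hu : u ∈ Um (s + 3) R) :
      ∃ (p : Fin (s + 2) → R) (q : R),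
        ∑ i, u (Fin.castSucc i) * p i + u (Fin.last (s + 2)) * q = 1 := by
    obtain ⟨p, hp⟩ := hu
    exact ⟨fun i => p i.castSucc, p (Fin.last _), (Fin.sum_univ_castSucc _).symm.trans hp⟩
  have last_mem (u : Fin (s + 3) → R) (hu : u ∈ UmRel (s + 3) R I) :
      u (Fin.last (s + 2)) ∈ I := by
    simpa using hu.2 (Fin.last (s + 2))
  have sub_mem' (i : Fin (s + 3)) : v i - w i ∈ I := by
    have h1 := hv.2 i
    have h2 := hw.2 i
    split_ifs at h1 h2
    · simpa using sub_mem h1 h2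
    · exact sub_mem h1 h2
  obtain ⟨d, z, z', ⟨e, he, hve⟩, ⟨f, hf, hwf⟩, hz⟩ := exists_elemRelOrbit_snoc hsr'
    (a := fun i => v i.castSucc) (b := fun i => w i.castSucc)
    (by simpa using hv.2 0) (fun i => sub_mem' i.castSucc) (last_mem v hv) (last_mem w hw)
    (unimodular v hv.1) (unimodular w hw.1)
  have snoc_eq (u : Fin (s + 3) → R) :
      (Fin.snoc (fun i : Fin (s + 2) => u i.castSucc) (u (Fin.last (s + 2))) : Fin (s + 3) → R) =
        u := Fin.snoc_init_self u
  rw [snoc_eq] at hve hwf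
  refine ⟨e, he, f, hf, z', ?_, ?_⟩
  · rw [hve, hwf, Fin.update_snoc_last]
  · rw [hve, Fin.snoc_last, hz, map_sub, map_one, Ideal.Quotient.eq_zero_iff_mem.2, sub_zero]
    · exact isUnit_one
    · exact Ideal.subset_span ⟨Fin.castSucc 0, (Fin.castSucc_lt_last 0).ne, by simp⟩
end
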